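/- arXiv:2102.02924 — 2 statements merged into one kernel-verified Lean document; each statement's English description precedes it below -/
import Mathlib

section
/- Let S₁ and S₂ be finite simple graphs on n₁ and n₂ vertices with Laplacian matrices L_{S₁}, L_{S₂}. Let d_1^{S₁} ≤ … ≤ d_{n₁}^{S₁} and d_1^{S₂} ≤ … ≤ d_{n₂}^{S₂} be their degree sequences sorted in ascending order, and let μ_1^{S₁} ≤ … ≤ μ_{n₁}^{S₁} and μ_1^{S₂} ≤ … ≤ μ_{n₂}^{S₂} be their Laplacian eigenvalues sorted in ascending order. Then for all 1 ≤ i ≤ n₁ and 1 ≤ j ≤ n₂, the estimated eigenvalue μ_{ij} = μ_i^{S₁} d_j^{S₂} + d_i^{S₁} μ_j^{S₂} − μ_i^{S₁} μ_j^{S₂} is nonnegative. -/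
open Matrix

/-- The quadratic form of a real Hermitian matrix in coordinates along its eigenvectors. -/
theorem Matrix.IsHermitian.dotProduct_mulVec_eq_sum_eigenvalues {m : Type*} [Fintype m]
    [DecidableEq m] {A : Matrix m m ℝ} (hA : A.IsHermitian) (x : m → ℝ) :
    x ⬝ᵥ A *ᵥ x =
      ∑ k, hA.eigenvalues k * ((hA.eigenvectorUnitary : Matrix m m ℝ)ᵀ *ᵥ x) k ^ 2 := by
  conv_lhs => rw [hA.spectral_theorem, Unitary.conjStarAlgAut_apply]
  rw [star_eq_conjTranspose, conjTranspose_eq_transpose_of_trivial, ← mulVec_mulVec,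
    ← mulVec_mulVec, dotProduct_mulVec, ← mulVec_transpose, dotProduct]
  refine Finset.sum_congr rfl fun k _ => ?_
  rw [mulVec_diagonal]
  simp only [Function.comp_apply, RCLike.ofReal_real_eq_id, id_eq]
  ring

theorem Matrix.IsHermitian.sum_sq_eigenvectorUnitary_transpose_mulVec {m : Type*} [Fintype m]
    [DecidableEq m] {A : Matrix m m ℝ} (hA : A.IsHermitian) (x : m → ℝ) :
    ∑ k, ((hA.eigenvectorUnitary : Matrix m m ℝ)ᵀ *ᵥ x) k ^ 2 = ∑ k, x k ^ 2 := by
  have hU : (hA.eigenvectorUnitary : Matrix m m ℝ) *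
      (hA.eigenvectorUnitary : Matrix m m ℝ)ᵀ = 1 := by
    rw [← conjTranspose_eq_transpose_of_trivial, ← star_eq_conjTranspose]
    exact Unitary.coe_mul_star_self _
  have h : ((hA.eigenvectorUnitary : Matrix m m ℝ)ᵀ *ᵥ x) ⬝ᵥ
      ((hA.eigenvectorUnitary : Matrix m m ℝ)ᵀ *ᵥ x) = x ⬝ᵥ x := by
    rw [dotProduct_mulVec, ← mulVec_transpose, transpose_transpose, mulVec_mulVec, hU, one_mulVec]
  simpa only [dotProduct, ← sq] using h

/-- If a real Hermitian matrix is bounded above by a diagonal matrix as a quadratic form, then its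
ascending eigenvalues are bounded by the ascending diagonal entries. -/
theorem Matrix.IsHermitian.sorted_eigenvalues_le_of_le_diagonal {ι m : Type*} [Fintype ι]
    [LinearOrder ι] [Fintype m] [DecidableEq m] {A : Matrix m m ℝ} (hA : A.IsHermitian)
    {c μ : ι → ℝ} (hc : Monotone c) (hμ : Monotone μ) (e f : ι ≃ m)
    (hf : ∀ k, μ k = hA.eigenvalues (f k))
    (hle : ∀ x : m → ℝ, x ⬝ᵥ A *ᵥ x ≤ ∑ k, c k * x (e k) ^ 2) (i : ι) : μ i ≤ c i := by
  set U : Matrix m m ℝ := (hA.eigenvectorUnitary : Matrix m m ℝ) with hU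
  let φ : (m → ℝ) →ₗ[ℝ] ({k // k ≠ i} → ℝ) := LinearMap.pi fun k =>
    if i < k.1 then LinearMap.proj (e k) else LinearMap.proj (f k) ∘ₗ Uᵀ.mulVecLin
  have hker : LinearMap.ker φ ≠ ⊥ := by
    refine LinearMap.ker_ne_bot_of_finrank_lt ?_
    rw [Module.finrank_fintype_fun_eq_card, Module.finrank_fintype_fun_eq_card,
      ← Fintype.card_congr e]
    exact Fintype.card_subtype_lt (x := i) (by simp)
  obtain ⟨x, hx, hx0⟩ := (Submodule.ne_bot_iff _).1 hker
  have hφ : ∀ k (hk : k ≠ i), φ x ⟨k, hk⟩ = 0 := fun k hk => by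
    rw [LinearMap.mem_ker.1 hx]; rfl
  have hupper : ∀ k, i < k → x (e k) = 0 := fun k hk => by
    simpa [φ, hk] using hφ k hk.ne'
  have hlower : ∀ k, k < i → (Uᵀ *ᵥ x) (f k) = 0 := fun k hk => by
    simpa [φ, hk.not_gt, mulVec_transpose] using hφ k hk.ne
  have hpos : 0 < ∑ k, x k ^ 2 := by
    obtain ⟨k, hk⟩ := Function.ne_iff.1 hx0
    exact Finset.sum_pos' (fun _ _ => sq_nonneg _) ⟨k, Finset.mem_univ _, sq_pos_iff.2 hk⟩
  have hlow : μ i * ∑ k, x k ^ 2 ≤ x ⬝ᵥ A *ᵥ x := by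
    rw [hA.dotProduct_mulVec_eq_sum_eigenvalues,
      ← hA.sum_sq_eigenvectorUnitary_transpose_mulVec, Finset.mul_sum, ← f.sum_comp,
      ← f.sum_comp (fun k => hA.eigenvalues k * _)]
    refine Finset.sum_le_sum fun k _ => ?_
    rw [← hf k]
    rcases lt_or_ge k i with hk | hk
    · simp [← hU, hlower k hk]
    · exact mul_le_mul_of_nonneg_right (hμ hk) (sq_nonneg _)
  have hup : ∑ k, c k * x (e k) ^ 2 ≤ c i * ∑ k, x k ^ 2 := by
    rw [Finset.mul_sum, ← e.sum_comp (fun k => c i * x k ^ 2)]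
    refine Finset.sum_le_sum fun k _ => ?_
    rcases lt_or_ge i k with hk | hk
    · simp [hupper k hk]
    · exact mul_le_mul_of_nonneg_right (hc hk) (sq_nonneg _)
  exact le_of_mul_le_mul_right (hlow.trans ((hle x).trans hup)) hpos

theorem SimpleGraph.dotProduct_lapMatrix_mulVec_le {V : Type*} [Fintype V] [DecidableEq V]
    (G : SimpleGraph V) [DecidableRel G.Adj] (x : V → ℝ) :
    x ⬝ᵥ G.lapMatrix ℝ *ᵥ x ≤ ∑ v, 2 * (G.degree v : ℝ) * x v ^ 2 := by
  have hdeg : ∑ v, (G.degree v : ℝ) * x v ^ 2 =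
      ∑ v, ∑ w, if G.Adj v w then x v ^ 2 else 0 := by
    refine Finset.sum_congr rfl fun v _ => ?_
    simp only [G.degree_eq_sum_if_adj (R := ℝ), Finset.sum_mul, ite_mul, one_mul, zero_mul]
  have hdeg' : ∑ v, (G.degree v : ℝ) * x v ^ 2 =
      ∑ v, ∑ w, if G.Adj v w then x w ^ 2 else 0 := by
    rw [hdeg, Finset.sum_comm]
    simp only [G.adj_comm]
  have hle : (∑ v, ∑ w, if G.Adj v w then (x v - x w) ^ 2 else 0) ≤
      2 * (∑ v, ∑ w, if G.Adj v w then x v ^ 2 else 0) +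
        2 * ∑ v, ∑ w, if G.Adj v w then x w ^ 2 else 0 := by
    simp only [Finset.mul_sum, ← Finset.sum_add_distrib]
    refine Finset.sum_le_sum fun v _ => Finset.sum_le_sum fun w _ => ?_
    split_ifs
    · nlinarith [sq_nonneg (x v + x w)]
    · simp
  rw [← hdeg, ← hdeg'] at hle
  rw [← toLinearMap₂'_apply', SimpleGraph.lapMatrix_toLinearMap₂']
  simp only [mul_assoc, ← Finset.mul_sum]
  linarith

/-- The ascending Laplacian eigenvalues are at most twice the ascending degrees. -/
theorem SimpleGraph.sorted_lapMatrix_eigenvalues_le_two_mul_degree {ι V : Type*} [Fintype ι]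
    [LinearOrder ι] [Fintype V] [DecidableEq V] (G : SimpleGraph V) [DecidableRel G.Adj]
    (hL : (G.lapMatrix ℝ).IsHermitian) {d μ : ι → ℝ} (hd : Monotone d) (hμ : Monotone μ)
    (hdeg : ∃ e : ι ≃ V, ∀ i, d i = (G.degree (e i) : ℝ))
    (heig : ∃ f : ι ≃ V, ∀ i, μ i = hL.eigenvalues (f i)) (i : ι) : μ i ≤ 2 * d i := by
  obtain ⟨e, he⟩ := hdeg
  obtain ⟨f, hf⟩ := heig
  refine hL.sorted_eigenvalues_le_of_le_diagonal (hd.const_mul zero_le_two) hμ e f hf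
    (fun x => (G.dotProduct_lapMatrix_mulVec_le x).trans_eq ?_) i
  rw [← e.sum_comp]
  simp only [he]

/-- Sayama's estimated Laplacian eigenvalues of a Kronecker product are nonnegative:
if `d₁, μ₁` (resp. `d₂, μ₂`) are the ascendingly sorted degrees and Laplacian
eigenvalues of `G₁` (resp. `G₂`), then
`μ₁ i * d₂ j + d₁ i * μ₂ j - μ₁ i * μ₂ j ≥ 0` for all `i, j`. -/
theorem sayama_estimated_eigenvalues_nonneg
    {n₁ n₂ : ℕ} (G₁ : SimpleGraph (Fin n₁)) (G₂ : SimpleGraph (Fin n₂))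
    [DecidableRel G₁.Adj] [DecidableRel G₂.Adj]
    (hL₁ : (G₁.lapMatrix ℝ).IsHermitian) (hL₂ : (G₂.lapMatrix ℝ).IsHermitian)
    (d₁ μ₁ : Fin n₁ → ℝ) (d₂ μ₂ : Fin n₂ → ℝ)
    (hd₁ : Monotone d₁) (hμ₁ : Monotone μ₁)
    (hd₂ : Monotone d₂) (hμ₂ : Monotone μ₂)
    (hdeg₁ : ∃ e : Fin n₁ ≃ Fin n₁, ∀ i, d₁ i = (G₁.degree (e i) : ℝ))
    (heig₁ : ∃ f : Fin n₁ ≃ Fin n₁, ∀ i, μ₁ i = hL₁.eigenvalues (f i))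
    (hdeg₂ : ∃ e : Fin n₂ ≃ Fin n₂, ∀ i, d₂ i = (G₂.degree (e i) : ℝ))
    (heig₂ : ∃ f : Fin n₂ ≃ Fin n₂, ∀ i, μ₂ i = hL₂.eigenvalues (f i)) :
    ∀ i j, 0 ≤ μ₁ i * d₂ j + d₁ i * μ₂ j - μ₁ i * μ₂ j := by
  intro i j
  have h₁ := G₁.sorted_lapMatrix_eigenvalues_le_two_mul_degree hL₁ hd₁ hμ₁ hdeg₁ heig₁ i
  have h₂ := G₂.sorted_lapMatrix_eigenvalues_le_two_mul_degree hL₂ hd₂ hμ₂ hdeg₂ heig₂ j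
  have hμ₁_nonneg : 0 ≤ μ₁ i := by
    obtain ⟨f, hf⟩ := heig₁
    exact hf i ▸ (SimpleGraph.posSemidef_lapMatrix ℝ G₁).eigenvalues_nonneg _
  have hμ₂_nonneg : 0 ≤ μ₂ j := by
    obtain ⟨f, hf⟩ := heig₂
    exact hf j ▸ (SimpleGraph.posSemidef_lapMatrix ℝ G₂).eigenvalues_nonneg _
  nlinarith [mul_nonneg hμ₁_nonneg (sub_nonneg.2 h₂), mul_nonneg hμ₂_nonneg (sub_nonneg.2 h₁)]
end

section
/- Let S₁ be a finite simple graph on n₁ vertices with at least one edge and degrees d_1^{S₁}, …, d_{n₁}^{S₁}, and let S₂ be a finite simple graph. Let w be a nonzero eigenvector of L_{S₂} with eigenvalue μ > 0. Then the correlation coefficient between the vectors L_{S₁⊗S₂}(1_{S₁} ⊗ w) and 1_{S₁} ⊗ w equals ((d_1^{S₁}+⋯+d_{n₁}^{S₁})/n₁) / √((d_1^{S₁}² + ⋯ + d_{n₁}^{S₁}²)/n₁), i.e., the arithmetic mean of the degrees of S₁ divided by their root mean square. -/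
open Matrix Kronecker Finset

theorem kronecker_mulVec_tensor {R l m n p : Type*} [CommSemiring R] [Fintype m] [Fintype p]
    (A : Matrix l m R) (B : Matrix n p R) (u : m → R) (v : p → R) :
    (A ⊗ₖ B) *ᵥ (fun q : m × p => u q.1 * v q.2)
      = fun q : l × n => (A *ᵥ u) q.1 * (B *ᵥ v) q.2 := by
  ext q
  simp only [Matrix.mulVec, dotProduct, Matrix.kroneckerMap_apply, Fintype.sum_prod_type,
    Finset.sum_mul_sum]
  exact Finset.sum_congr rfl fun _ _ => Finset.sum_congr rfl fun _ _ => by ring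

theorem tensor_dotProduct_tensor {R m n : Type*} [CommSemiring R] [Fintype m] [Fintype n]
    (u u' : m → R) (v v' : n → R) :
    (fun q : m × n => u q.1 * v q.2) ⬝ᵥ (fun q : m × n => u' q.1 * v' q.2)
      = (u ⬝ᵥ u') * (v ⬝ᵥ v') := by
  simp only [dotProduct, Fintype.sum_prod_type, Finset.sum_mul_sum]
  exact Finset.sum_congr rfl fun _ _ => Finset.sum_congr rfl fun _ _ => by ring

theorem lapKron_mulVec_ones_tensor
    {α β : Type*} [Fintype α] [Fintype β] [DecidableEq α] [DecidableEq β]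
    (G : SimpleGraph α) (H : SimpleGraph β) [DecidableRel G.Adj] [DecidableRel H.Adj]
    (w : β → ℝ) :
    ((Matrix.diagonal fun i => (G.degree i : ℝ)) ⊗ₖ (Matrix.diagonal fun j => (H.degree j : ℝ))
        - G.adjMatrix ℝ ⊗ₖ H.adjMatrix ℝ) *ᵥ (fun p : α × β => 1 * w p.2)
      = fun p : α × β => (G.degree p.1 : ℝ) * (H.lapMatrix ℝ *ᵥ w) p.2 := by
  have h₁ := kronecker_mulVec_tensor (Matrix.diagonal fun i => (G.degree i : ℝ))
    (Matrix.diagonal fun j => (H.degree j : ℝ)) (fun _ => 1) w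
  have h₂ := kronecker_mulVec_tensor (G.adjMatrix ℝ) (H.adjMatrix ℝ) (fun _ => 1) w
  rw [Matrix.sub_mulVec, h₁, h₂]
  ext p
  simp [SimpleGraph.lapMatrix, SimpleGraph.degMatrix, Matrix.sub_mulVec, Matrix.mulVec_diagonal,
    SimpleGraph.adjMatrix_mulVec_apply, mul_sub]

/-- Let `G` have at least one edge and let `w` be a nonzero eigenvector of `L_H` with
eigenvalue `μ > 0`. Then the correlation coefficient (cosine of the angle) between
`L_{G⊗H}(1_G ⊗ w)` and `1_G ⊗ w` equals the arithmetic mean of the degrees of `G`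
divided by their root mean square. -/
theorem corr_lapKron_ones_tensor_eigvec
    {α β : Type*} [Fintype α] [Fintype β] [DecidableEq α] [DecidableEq β]
    (G : SimpleGraph α) (H : SimpleGraph β) [DecidableRel G.Adj] [DecidableRel H.Adj]
    (hE : G.edgeFinset.Nonempty)
    (w : β → ℝ) (μ : ℝ) (hw0 : w ≠ 0) (hμ : 0 < μ) (hw : H.lapMatrix ℝ *ᵥ w = μ • w) :
    (((( (Matrix.diagonal fun i => (G.degree i : ℝ)) ⊗ₖ
          (Matrix.diagonal fun j => (H.degree j : ℝ))
        - G.adjMatrix ℝ ⊗ₖ H.adjMatrix ℝ) *ᵥ (fun p : α × β => 1 * w p.2))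
        ⬝ᵥ (fun p : α × β => 1 * w p.2))
      / (Real.sqrt ((((Matrix.diagonal fun i => (G.degree i : ℝ)) ⊗ₖ
            (Matrix.diagonal fun j => (H.degree j : ℝ))
          - G.adjMatrix ℝ ⊗ₖ H.adjMatrix ℝ) *ᵥ (fun p : α × β => 1 * w p.2))
            ⬝ᵥ ((((Matrix.diagonal fun i => (G.degree i : ℝ)) ⊗ₖ
            (Matrix.diagonal fun j => (H.degree j : ℝ))
          - G.adjMatrix ℝ ⊗ₖ H.adjMatrix ℝ)) *ᵥ (fun p : α × β => 1 * w p.2)))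
          * Real.sqrt ((fun p : α × β => 1 * w p.2) ⬝ᵥ (fun p : α × β => 1 * w p.2))))
      = ((∑ i, (G.degree i : ℝ)) / (Fintype.card α : ℝ))
          / Real.sqrt ((∑ i, (G.degree i : ℝ) ^ 2) / (Fintype.card α : ℝ)) := by
  have hn : 0 < (Fintype.card α : ℝ) := by
    obtain ⟨e, -⟩ := hE
    have : Nonempty α := ⟨(Quot.out e).1⟩
    exact_mod_cast Fintype.card_pos
  have hW : 0 < w ⬝ᵥ w :=
    lt_of_le_of_ne (Finset.sum_nonneg fun i _ => mul_self_nonneg (w i))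
      (Ne.symm (mt dotProduct_self_eq_zero.1 hw0))
  rw [lapKron_mulVec_ones_tensor, hw,
    tensor_dotProduct_tensor (fun i => (G.degree i : ℝ)) (fun _ => 1) (μ • w) w,
    tensor_dotProduct_tensor (fun i => (G.degree i : ℝ)) (fun i => (G.degree i : ℝ))
      (μ • w) (μ • w),
    tensor_dotProduct_tensor (fun _ : α => (1 : ℝ)) (fun _ => 1) w w]
  have hD : (fun i => (G.degree i : ℝ)) ⬝ᵥ (fun _ => 1) = ∑ i, (G.degree i : ℝ) := by
    simp [dotProduct]
  have hQ : (fun i => (G.degree i : ℝ)) ⬝ᵥ (fun i => (G.degree i : ℝ))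
      = ∑ i, (G.degree i : ℝ) ^ 2 := by
    simp [dotProduct, sq]
  have hN : (fun _ : α => (1 : ℝ)) ⬝ᵥ (fun _ => 1) = Fintype.card α := by
    simp [dotProduct]
  have hQ0 : 0 ≤ ∑ i, (G.degree i : ℝ) ^ 2 := Finset.sum_nonneg fun i _ => sq_nonneg _
  rw [hD, hQ, hN, smul_dotProduct, smul_dotProduct, dotProduct_smul, smul_eq_mul, smul_eq_mul]
  generalize (∑ i, (G.degree i : ℝ)) = D
  generalize (∑ i, (G.degree i : ℝ) ^ 2) = Q at hQ0
  generalize (Fintype.card α : ℝ) = n at hn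
  generalize w ⬝ᵥ w = W at hW
  have hsn := Real.sqrt_pos.2 hn
  rw [← mul_assoc μ μ W, Real.sqrt_mul hQ0, Real.sqrt_mul (mul_self_nonneg μ),
    Real.sqrt_mul_self hμ.le, Real.sqrt_mul hn.le, Real.sqrt_div hQ0]
  have hden : √Q * (μ * √W) * (√n * √W) = (μ * W) * (√Q * √n) := by
    linear_combination (√Q * μ * √n) * Real.mul_self_sqrt hW.le
  rw [hden, mul_comm D, mul_div_mul_left _ _ (mul_pos hμ hW).ne', div_div_div_eq]
  nth_rewrite 3 [← Real.mul_self_sqrt hn.le]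
  rw [mul_comm D, mul_assoc, mul_div_mul_left _ _ hsn.ne', mul_comm √Q]
end
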